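/- Let d, N ≥ 1, T > 0, and let G : P_2(ℝ^d) → ℝ be bounded from below. Then for every t_0 ∈ [0,T) and x ∈ (ℝ^d)^N, V^N(t_0, x) ≤ Ũ(t_0, m_x^N), where Ũ is the value over controls that are measurable functions of time and the initial condition only: Ũ(t_0, m_0) := inf over measurable α : [t_0,T] × ℝ^d → ℝ^d with ∫_{t_0}^T ∫_{ℝ^d} |α_t(ξ)|² dm_0(ξ) dt < ∞ of { ∫_{t_0}^T ∫_{ℝ^d} (1/2)|α_t(ξ)|² dm_0(ξ) dt + G((Φ_α)_# m_0) }, with Φ_α(ξ) := ξ + ∫_{t_0}^T α_s(ξ) ds and (Φ_α)_# m_0 the pushforward of m_0 by Φ_α. -/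

import Mathlib

open MeasureTheory Filter
open scoped ENNReal NNReal BigOperators

noncomputable section

/-- `Ed d` is the Euclidean space `ℝ^d`. -/
abbrev Ed (d : ℕ) := EuclideanSpace ℝ (Fin d)

/-- A Borel probability measure on `ℝ^d` with finite second moment,
i.e. an element of `P_2(ℝ^d)`. -/
def IsP2 {d : ℕ} (μ : Measure (Ed d)) : Prop :=
  IsProbabilityMeasure μ ∧ Integrable (fun x => ‖x‖ ^ 2) μ

/-- The empirical measure `m_x^N = (1/N) ∑ δ_{x^i}`. -/
def empMeas {d N : ℕ} (x : Fin N → Ed d) : Measure (Ed d) :=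
  (N : ℝ≥0∞)⁻¹ • ∑ i, Measure.dirac (x i)

/-- `π` is a coupling of `μ` and `ν`. -/
def IsCoupling {d : ℕ} (π : Measure (Ed d × Ed d)) (μ ν : Measure (Ed d)) : Prop :=
  IsProbabilityMeasure π ∧ π.map Prod.fst = μ ∧ π.map Prod.snd = ν

/-- The squared 2-Wasserstein distance `d_2(μ,ν)²`, as the infimum over couplings of
`∫ |x - y|² dπ(x,y)` (with value in `[0,∞]`). -/
def d2sq {d : ℕ} (μ ν : Measure (Ed d)) : ℝ≥0∞ :=
  ⨅ (π : Measure (Ed d × Ed d)) (_ : IsCoupling π μ ν),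
    ∫⁻ p, (‖p.1 - p.2‖₊ : ℝ≥0∞) ^ 2 ∂π

/-- The 2-Wasserstein distance `d_2(μ,ν)`. -/
def d2 {d : ℕ} (μ ν : Measure (Ed d)) : ℝ := Real.sqrt (d2sq μ ν).toReal

/-- The 1-Wasserstein distance, via Kantorovich duality:
`d_1(μ,ν) = sup { ∫ f dμ - ∫ f dν : f 1-Lipschitz }`. -/
def d1 {d : ℕ} (μ ν : Measure (Ed d)) : ℝ :=
  sSup { r | ∃ f : Ed d → ℝ, LipschitzWith 1 f ∧ r = (∫ x, f x ∂μ) - ∫ x, f x ∂ν }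

/-- The Hopf–Lax mean-field value function
`U(t,m) = inf_{ν ∈ P_2} { G(ν) + d_2(m,ν)²/(2(T-t)) }`. -/
def MFval {d : ℕ} (T : ℝ) (G : Measure (Ed d) → ℝ) (t : ℝ) (m : Measure (Ed d)) : ℝ :=
  sInf { r | ∃ ν : Measure (Ed d), IsP2 ν ∧
    r = G ν + (d2sq m ν).toReal / (2 * (T - t)) }

/-- The Hopf–Lax `N`-particle value function
`V^N(t,x) = inf_y { G(m_y^N) + (1/(2(T-t)N)) ∑ |x^i - y^i|² }`. -/
def NPval {d N : ℕ} (T : ℝ) (G : Measure (Ed d) → ℝ) (t : ℝ) (x : Fin N → Ed d) : ℝ :=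
  sInf { r | ∃ y : Fin N → Ed d,
    r = G (empMeas y) + (1 / (2 * (T - t) * (N : ℝ))) * ∑ i, ‖x i - y i‖ ^ 2 }

/-- The value `Ũ(t_0, m_0)` of the deterministic mean-field control problem restricted to
controls that are measurable functions of time and the initial condition only. -/
def Utilde {d : ℕ} (T : ℝ) (G : Measure (Ed d) → ℝ) (t0 : ℝ) (m0 : Measure (Ed d)) : ℝ :=
  sInf { r : ℝ | ∃ α : ℝ → Ed d → Ed d,
    Measurable (Function.uncurry α) ∧
    (∫⁻ t in Set.Ioc t0 T, ∫⁻ ξ, (‖α t ξ‖₊ : ℝ≥0∞) ^ 2 ∂m0) < ⊤ ∧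
    r = (∫ t in t0..T, ∫ ξ, (1 / 2) * ‖α t ξ‖ ^ 2 ∂m0)
        + G (m0.map fun ξ => ξ + ∫ t in t0..T, α t ξ) }

/-- The Cauchy–Schwarz inequality `|∫_a^b f|² ≤ (b - a) ∫_a^b |f|²`. -/
lemma norm_intervalIntegral_sq_le {E : Type*} [NormedAddCommGroup E] [NormedSpace ℝ E]
    {f : ℝ → E} {a b : ℝ} (hab : a < b) (hf : IntervalIntegrable f volume a b)
    (hf2 : IntervalIntegrable (fun t => ‖f t‖ ^ 2) volume a b) :
    ‖∫ t in a..b, f t‖ ^ 2 ≤ (b - a) * ∫ t in a..b, ‖f t‖ ^ 2 := by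
  have hba : 0 < b - a := sub_pos.2 hab
  set I := ∫ t in a..b, ‖f t‖ with hI
  have hle : ‖∫ t in a..b, f t‖ ≤ I := intervalIntegral.norm_integral_le_integral_norm hab.le
  have hmono : ∫ t in a..b, 2 * (b - a) * I * ‖f t‖ ≤
      ∫ t in a..b, ((b - a) ^ 2 * ‖f t‖ ^ 2 + I ^ 2) := by
    refine intervalIntegral.integral_mono_on hab.le (hf.norm.const_mul _)
      ((hf2.const_mul _).add intervalIntegrable_const) fun t _ => ?_
    nlinarith [sq_nonneg ((b - a) * ‖f t‖ - I)]
  rw [intervalIntegral.integral_const_mul,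
    intervalIntegral.integral_add (hf2.const_mul _) intervalIntegrable_const,
    intervalIntegral.integral_const_mul, intervalIntegral.integral_const, ← hI,
    smul_eq_mul] at hmono
  have hI2 : I ^ 2 ≤ (b - a) * ∫ t in a..b, ‖f t‖ ^ 2 :=
    le_of_mul_le_mul_left (by linarith) hba
  exact (pow_le_pow_left₀ (norm_nonneg _) hle 2).trans hI2

lemma integral_empMeas {d N : ℕ} (x : Fin N → Ed d) (f : Ed d → ℝ) :
    ∫ ξ, f ξ ∂empMeas x = (N : ℝ)⁻¹ * ∑ i, f (x i) := by
  rw [empMeas, integral_smul_measure, integral_finsetSum_measure]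
  · simp
  · exact fun i _ => integrable_dirac (by simp)

lemma lintegral_empMeas {d N : ℕ} (x : Fin N → Ed d) (f : Ed d → ℝ≥0∞) :
    ∫⁻ ξ, f ξ ∂empMeas x = (N : ℝ≥0∞)⁻¹ * ∑ i, f (x i) := by
  simp [empMeas, lintegral_smul_measure, lintegral_finsetSum_measure]

lemma map_empMeas {d N : ℕ} (x : Fin N → Ed d) {φ : Ed d → Ed d} (hφ : Measurable φ) :
    (empMeas x).map φ = empMeas (fun i => φ (x i)) := by
  rw [empMeas, Measure.map_smul, ← Measure.mapₗ_apply_of_measurable hφ, map_sum]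
  simp [empMeas, Measure.mapₗ_apply_of_measurable hφ, Measure.map_dirac' hφ]

lemma isP2_empMeas {d N : ℕ} (hN : 1 ≤ N) (x : Fin N → Ed d) : IsP2 (empMeas x) := by
  have hN0 : (N : ℝ≥0∞) ≠ 0 := by simp; omega
  refine ⟨⟨?_⟩, ?_⟩
  · simp [empMeas, ENNReal.inv_mul_cancel hN0 (ENNReal.natCast_ne_top N)]
  · refine Integrable.smul_measure ?_ (ENNReal.inv_ne_top.2 hN0)
    exact integrable_finsetSum_measure.2 fun i _ => integrable_dirac (by simp)

lemma bddBelow_NPval_set {d N : ℕ} (hN : 1 ≤ N) {T t : ℝ} (ht : t < T)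
    {G : Measure (Ed d) → ℝ} (hG : ∃ c : ℝ, ∀ μ : Measure (Ed d), IsP2 μ → c ≤ G μ)
    (x : Fin N → Ed d) :
    BddBelow { r | ∃ y : Fin N → Ed d,
      r = G (empMeas y) + (1 / (2 * (T - t) * (N : ℝ))) * ∑ i, ‖x i - y i‖ ^ 2 } := by
  obtain ⟨c, hc⟩ := hG
  refine ⟨c, ?_⟩
  rintro _ ⟨y, rfl⟩
  have hTt : 0 < T - t := sub_pos.2 ht
  have h0 : 0 ≤ (1 / (2 * (T - t) * (N : ℝ))) * ∑ i, ‖x i - y i‖ ^ 2 := by positivity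
  linarith [hc _ (isP2_empMeas hN y)]

/-- A control with finite energy with respect to `m_x^N` is square integrable in time along each
of the atoms `x^i`. -/
lemma memLp_control_apply {d N : ℕ} {x : Fin N → Ed d} {α : ℝ → Ed d → Ed d} {a b : ℝ}
    (hα : Measurable (Function.uncurry α))
    (hfin : (∫⁻ t in Set.Ioc a b, ∫⁻ ξ, (‖α t ξ‖₊ : ℝ≥0∞) ^ 2 ∂empMeas x) < ⊤) (i : Fin N) :
    MemLp (fun t => α t (x i)) 2 (volume.restrict (Set.Ioc a b)) := by
  have hm : Measurable fun t => α t (x i) := hα.of_uncurry_right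
  refine ⟨hm.aestronglyMeasurable, ?_⟩
  rw [eLpNorm_lt_top_iff_lintegral_rpow_enorm_lt_top (by simp) (by simp)]
  have hle : (N : ℝ≥0∞)⁻¹ * ∫⁻ t in Set.Ioc a b, (‖α t (x i)‖₊ : ℝ≥0∞) ^ 2 ≤
      ∫⁻ t in Set.Ioc a b, ∫⁻ ξ, (‖α t ξ‖₊ : ℝ≥0∞) ^ 2 ∂empMeas x := by
    rw [← lintegral_const_mul _ (by fun_prop)]
    refine lintegral_mono fun t => ?_
    rw [lintegral_empMeas]
    gcongr
    exact Finset.single_le_sum (f := fun j => (‖α t (x j)‖₊ : ℝ≥0∞) ^ 2)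
      (fun _ _ => zero_le) (Finset.mem_univ i)
  have hlt := ENNReal.lt_top_of_mul_ne_top_right (hle.trans_lt hfin).ne (by simp)
  simpa [enorm_eq_nnnorm] using hlt

/-- `V^N(t_0, x) ≤ Ũ(t_0, m_x^N)`: the `N`-particle value is below the
mean-field value over controls depending only on time and the initial condition. -/
theorem nParticleVal_le_Utilde {d N : ℕ} (hd : 1 ≤ d) (hN : 1 ≤ N)
    (T : ℝ) (hT : 0 < T)
    (G : Measure (Ed d) → ℝ)
    (hGbd : ∃ c : ℝ, ∀ μ : Measure (Ed d), IsP2 μ → c ≤ G μ)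
    (t0 : ℝ) (ht0 : 0 ≤ t0) (ht0T : t0 < T) (x : Fin N → Ed d) :
    NPval T G t0 x ≤ Utilde T G t0 (empMeas x) := by
  have hTt : 0 < T - t0 := sub_pos.2 ht0T
  have hN0 : (0 : ℝ) < N := by exact_mod_cast hN
  refine le_csInf ⟨_, fun _ _ => 0, measurable_const, by simp, rfl⟩ ?_
  rintro _ ⟨α, hα, hfin, rfl⟩
  set Φ : Ed d → Ed d := fun ξ => ξ + ∫ t in t0..T, α t ξ with hΦ
  have hΦm : Measurable Φ := by
    refine measurable_id.add ?_
    simp_rw [intervalIntegral.integral_of_le ht0T.le]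
    exact hα.stronglyMeasurable.integral_prod_left'.measurable
  refine (csInf_le (bddBelow_NPval_set hN ht0T hGbd x) ⟨fun i => Φ (x i), rfl⟩).trans ?_
  rw [map_empMeas x hΦm, add_comm]
  gcongr
  have hL := memLp_control_apply hα hfin
  have h1 : ∀ i, IntervalIntegrable (fun t => α t (x i)) volume t0 T := fun i =>
    (intervalIntegrable_iff_integrableOn_Ioc_of_le ht0T.le).2 ((hL i).integrable (by norm_num))
  have h2 : ∀ i, IntervalIntegrable (fun t => ‖α t (x i)‖ ^ 2) volume t0 T := fun i =>
    (intervalIntegrable_iff_integrableOn_Ioc_of_le ht0T.le).2 (hL i).integrable_norm_pow'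
  simp_rw [integral_empMeas]
  rw [intervalIntegral.integral_const_mul,
    intervalIntegral.integral_finsetSum fun i _ => (h2 i).const_mul _, Finset.mul_sum,
    Finset.mul_sum]
  refine Finset.sum_le_sum fun i _ => ?_
  have hΦx : ‖x i - Φ (x i)‖ = ‖∫ t in t0..T, α t (x i)‖ := by simp [hΦ]
  rw [intervalIntegral.integral_const_mul, hΦx]
  calc 1 / (2 * (T - t0) * N) * ‖∫ t in t0..T, α t (x i)‖ ^ 2
      ≤ 1 / (2 * (T - t0) * N) * ((T - t0) * ∫ t in t0..T, ‖α t (x i)‖ ^ 2) := by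
        gcongr
        exact norm_intervalIntegral_sq_le ht0T (h1 i) (h2 i)
    _ = (N : ℝ)⁻¹ * (1 / 2 * ∫ t in t0..T, ‖α t (x i)‖ ^ 2) := by
        field_simp

end
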